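/- arXiv:2011.10792 — 5 statements merged into one kernel-verified Lean document; each statement's English description precedes it below -/
import Mathlib

section
/- Let L, H, c, g > 0 and let k : ℝ → ℝ be continuously differentiable. Suppose s is C¹ and p is C² on an open set containing [0,L] × (0,H), that the travelling-wave Richards equation c ∂_z s = ∂_y(k(s) ∂_y p) + ∂_z(k(s)(∂_z p + g)) holds at every point of [0,L] × (0,H), and that the homogeneous lateral Neumann conditions ∂_y p(0,z) = ∂_y p(L,z) = 0 hold for all z ∈ (0,H). Then the flux F_c(z) := ∫₀^L [k(s(y,z))(∂_z p(y,z) + g) − c s(y,z)] dy is constant on (0,H). -/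
open MeasureTheory Set Filter

/-- Partial derivative in the first (horizontal, `y`) variable. -/
noncomputable def pdy (f : ℝ × ℝ → ℝ) (x : ℝ × ℝ) : ℝ := deriv (fun t => f (t, x.2)) x.1

/-- Partial derivative in the second (vertical, `z`) variable. -/
noncomputable def pdz (f : ℝ × ℝ → ℝ) (x : ℝ × ℝ) : ℝ := deriv (fun t => f (x.1, t)) x.2

theorem pdy_eq_fderiv {f : ℝ × ℝ → ℝ} {x : ℝ × ℝ} (hf : DifferentiableAt ℝ f x) :
    pdy f x = fderiv ℝ f x (1, 0) :=
  (hf.hasFDerivAt.comp_hasDerivAt x.1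
    ((hasDerivAt_id x.1).prodMk (hasDerivAt_const x.1 x.2))).deriv

theorem pdz_eq_fderiv {f : ℝ × ℝ → ℝ} {x : ℝ × ℝ} (hf : DifferentiableAt ℝ f x) :
    pdz f x = fderiv ℝ f x (0, 1) :=
  (hf.hasFDerivAt.comp_hasDerivAt x.2
    ((hasDerivAt_const x.2 x.1).prodMk (hasDerivAt_id x.2))).deriv

theorem contDiffOn_pdy {p : ℝ × ℝ → ℝ} {U : Set (ℝ × ℝ)} (hU : IsOpen U)
    (hp : ContDiffOn ℝ 2 p U) : ContDiffOn ℝ 1 (pdy p) U :=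
  ((hp.fderiv_of_isOpen hU (by norm_num)).clm_apply contDiffOn_const).congr fun x hx =>
    pdy_eq_fderiv ((hp.contDiffAt (hU.mem_nhds hx)).differentiableAt (by norm_num))

theorem contDiffOn_pdz {p : ℝ × ℝ → ℝ} {U : Set (ℝ × ℝ)} (hU : IsOpen U)
    (hp : ContDiffOn ℝ 2 p U) : ContDiffOn ℝ 1 (pdz p) U :=
  ((hp.fderiv_of_isOpen hU (by norm_num)).clm_apply contDiffOn_const).congr fun x hx =>
    pdz_eq_fderiv ((hp.contDiffAt (hU.mem_nhds hx)).differentiableAt (by norm_num))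

/-- A divergence-free `C¹` field whose horizontal component vanishes on the lateral sides of a
rectangle has the same vertical flux through the bottom and the top. -/
theorem integral_eq_of_divergence_eq_zero {f h : ℝ × ℝ → ℝ} {U : Set (ℝ × ℝ)} (hU : IsOpen U)
    (hf : ContDiffOn ℝ 1 f U) (hh : ContDiffOn ℝ 1 h U) {a b z₁ z₂ : ℝ}
    (hsub : uIcc a b ×ˢ uIcc z₁ z₂ ⊆ U)
    (hdiv : ∀ x ∈ uIcc a b ×ˢ uIcc z₁ z₂, pdy f x + pdz h x = 0)
    (hlat : ∀ z ∈ uIcc z₁ z₂, f (a, z) = 0 ∧ f (b, z) = 0) :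
    ∫ y in a..b, h (y, z₁) = ∫ y in a..b, h (y, z₂) := by
  have hdf : ∀ x ∈ U, DifferentiableAt ℝ f x := fun x hx =>
    (hf.contDiffAt (hU.mem_nhds hx)).differentiableAt (by norm_num)
  have hdh : ∀ x ∈ U, DifferentiableAt ℝ h x := fun x hx =>
    (hh.contDiffAt (hU.mem_nhds hx)).differentiableAt (by norm_num)
  have hzero : ∀ x ∈ uIcc a b ×ˢ uIcc z₁ z₂,
      fderiv ℝ f x (1, 0) + fderiv ℝ h x (0, 1) = 0 := fun x hx => by
    rw [← pdy_eq_fderiv (hdf x (hsub hx)), ← pdz_eq_fderiv (hdh x (hsub hx)), hdiv x hx]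
  have hIoo : Ioo (min a b) (max a b) ×ˢ Ioo (min z₁ z₂) (max z₁ z₂) ⊆ U :=
    (Set.prod_mono Ioo_subset_Icc_self Ioo_subset_Icc_self).trans hsub
  have key := integral2_divergence_prod_of_hasFDerivAt f h (fderiv ℝ f) (fderiv ℝ h) a z₁ b z₂
    (hf.continuousOn.mono hsub) (hh.continuousOn.mono hsub)
    (fun x hx => (hdf x (hIoo hx)).hasFDerivAt) (fun x hx => (hdh x (hIoo hx)).hasFDerivAt)
    (integrableOn_zero.congr_fun (fun x hx => (hzero x hx).symm)
      (measurableSet_uIcc.prod measurableSet_uIcc))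
  have hdiv_int : (∫ y in a..b, ∫ z in z₁..z₂,
      fderiv ℝ f (y, z) (1, 0) + fderiv ℝ h (y, z) (0, 1)) = 0 := by
    refine (intervalIntegral.integral_congr (g := fun _ => (0 : ℝ)) fun y hy => ?_).trans
      intervalIntegral.integral_zero
    exact (intervalIntegral.integral_congr (g := fun _ => (0 : ℝ)) fun z hz =>
      hzero (y, z) ⟨hy, hz⟩).trans intervalIntegral.integral_zero
  have hleft : ∫ z in z₁..z₂, f (a, z) = 0 :=
    (intervalIntegral.integral_congr (g := fun _ => (0 : ℝ)) fun z hz => (hlat z hz).1).trans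
      intervalIntegral.integral_zero
  have hright : ∫ z in z₁..z₂, f (b, z) = 0 :=
    (intervalIntegral.integral_congr (g := fun _ => (0 : ℝ)) fun z hz => (hlat z hz).2).trans
      intervalIntegral.integral_zero
  rw [hdiv_int, hleft, hright] at key
  linarith

/-- The flux `F_c(z) = ∫₀^L [k(s(y,z))(∂_z p(y,z) + g) − c s(y,z)] dy` is constant on `(0,H)`. -/
theorem flux_constant_on_strip
    (L H c g : ℝ) (hL : 0 < L) (hH : 0 < H) (hc : 0 < c) (hg : 0 < g)
    (k : ℝ → ℝ) (hk : ContDiff ℝ 1 k)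
    (s p : ℝ × ℝ → ℝ) (U : Set (ℝ × ℝ)) (hU : IsOpen U)
    (hUsub : Icc (0:ℝ) L ×ˢ Ioo (0:ℝ) H ⊆ U)
    (hs : ContDiffOn ℝ 1 s U) (hp : ContDiffOn ℝ 2 p U)
    (hRich : ∀ x ∈ Icc (0:ℝ) L ×ˢ Ioo (0:ℝ) H,
      c * pdz s x =
        pdy (fun x' => k (s x') * pdy p x') x
          + pdz (fun x' => k (s x') * (pdz p x' + g)) x)
    (hNeu : ∀ z ∈ Ioo (0:ℝ) H, pdy p (0, z) = 0 ∧ pdy p (L, z) = 0) :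
    ∀ z₁ ∈ Ioo (0:ℝ) H, ∀ z₂ ∈ Ioo (0:ℝ) H,
      (∫ y in (0:ℝ)..L, (k (s (y, z₁)) * (pdz p (y, z₁) + g) - c * s (y, z₁)))
        = ∫ y in (0:ℝ)..L, (k (s (y, z₂)) * (pdz p (y, z₂) + g) - c * s (y, z₂)) := by
  intro z₁ hz₁ z₂ hz₂
  have hz : uIcc z₁ z₂ ⊆ Ioo (0 : ℝ) H := ordConnected_Ioo.uIcc_subset hz₁ hz₂
  have hrect : uIcc 0 L ×ˢ uIcc z₁ z₂ ⊆ Icc (0 : ℝ) L ×ˢ Ioo (0 : ℝ) H :=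
    Set.prod_mono (uIcc_of_le hL.le).subset hz
  have hks : ContDiffOn ℝ 1 (fun x => k (s x)) U := hk.comp_contDiffOn hs
  have hvert : ContDiffOn ℝ 1 (fun x => k (s x) * (pdz p x + g)) U :=
    hks.mul ((contDiffOn_pdz hU hp).add contDiffOn_const)
  have hcs : ContDiffOn ℝ 1 (fun x => c * s x) U := contDiffOn_const.mul hs
  refine integral_eq_of_divergence_eq_zero (f := fun x => k (s x) * pdy p x)
    (h := fun x => k (s x) * (pdz p x + g) - c * s x) hU (hks.mul (contDiffOn_pdy hU hp))
    (hvert.sub hcs) (hrect.trans hUsub) (fun x hx => ?_) fun z hz' => ?_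
  · have hxU := hU.mem_nhds (hUsub (hrect hx))
    have hdv := (hvert.contDiffAt hxU).differentiableAt (by norm_num)
    have hds := (hs.contDiffAt hxU).differentiableAt (by norm_num)
    have hdcs := (hcs.contDiffAt hxU).differentiableAt (by norm_num)
    have hsplit : pdz (fun x => k (s x) * (pdz p x + g) - c * s x) x
        = pdz (fun x => k (s x) * (pdz p x + g)) x - c * pdz s x := by
      rw [pdz_eq_fderiv (hdv.fun_sub hdcs), pdz_eq_fderiv hdv, pdz_eq_fderiv hds,
        fderiv_fun_sub hdv hdcs, fderiv_const_mul hds]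
      rfl
    rw [hsplit, hRich x (hrect hx)]
    ring
  · obtain ⟨h0, h1⟩ := hNeu z (hz hz')
    exact ⟨by simp [h0], by simp [h1]⟩
end

section
/- Let L, c, g, τ > 0, F_∞ ∈ ℝ, s_* ∈ (0,1), let k : ℝ → ℝ be continuously differentiable, and let p_c : (0,1) → ℝ be continuous. Let s be C¹ and p be C² on an open set containing [0,L] × ℝ, with 0 < s < 1, satisfying at every point the travelling-wave Richards equation c ∂_z s = ∂_y(k(s) ∂_y p) + ∂_z(k(s)(∂_z p + g)) and the hysteresis relation c τ ∂_z s = max(p − p_c(s), 0), together with the homogeneous lateral Neumann conditions ∂_y p(0,z) = ∂_y p(L,z) = 0 for all z ∈ ℝ. Assume that as z → −∞, s(·,z) → s_* uniformly on [0,L] and k(s(·,z)) ∇p(·,z) → 0 uniformly on [0,L], and that as z → +∞, ∫₀^L k(s(y,z))(∂_z p(y,z) + g) dy → F_∞. Then for every y ∈ [0,L] the limit s*(y) := lim_{z→∞} s(y,z) exists, and c ∫₀^L (s*(y) − s_*) dy = F_∞ − k(s_*) g L. -/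
open MeasureTheory Set Filter

/-- The vertical partial derivative is the Fréchet derivative in direction `(0, 1)`. -/
theorem hasDerivAt_pdz {f : ℝ × ℝ → ℝ} {x : ℝ × ℝ} (hf : DifferentiableAt ℝ f x) :
    HasDerivAt (fun t => f (x.1, t)) (fderiv ℝ f x (0, 1)) x.2 := by
  have h : HasDerivAt (fun t : ℝ => (x.1, t)) ((0 : ℝ), (1 : ℝ)) x.2 :=
    (hasDerivAt_const x.2 x.1).prodMk (hasDerivAt_id x.2)
  exact HasFDerivAt.comp_hasDerivAt (l := f) x.2 (f := fun t : ℝ => (x.1, t)) hf.hasFDerivAt h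

theorem ContDiffOn.pdy {f : ℝ × ℝ → ℝ} {U : Set (ℝ × ℝ)} (hU : IsOpen U)
    (hf : ContDiffOn ℝ 2 f U) : ContDiffOn ℝ 1 (pdy f) U := by
  have h : ContDiffOn ℝ 1 (fun x => fderiv ℝ f x (1, 0)) U :=
    (hf.fderiv_of_isOpen hU (by norm_num [one_add_one_eq_two])).clm_apply contDiffOn_const
  exact h.congr fun x hx =>
    pdy_eq_fderiv ((hf.contDiffAt (hU.mem_nhds hx)).differentiableAt (by norm_num))

theorem ContDiffOn.pdz {f : ℝ × ℝ → ℝ} {U : Set (ℝ × ℝ)} (hU : IsOpen U)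
    (hf : ContDiffOn ℝ 2 f U) : ContDiffOn ℝ 1 (pdz f) U := by
  have h : ContDiffOn ℝ 1 (fun x => fderiv ℝ f x (0, 1)) U :=
    (hf.fderiv_of_isOpen hU (by norm_num [one_add_one_eq_two])).clm_apply contDiffOn_const
  exact h.congr fun x hx =>
    pdz_eq_fderiv ((hf.contDiffAt (hU.mem_nhds hx)).differentiableAt (by norm_num))

/-- The flux of a divergence-free field through horizontal cross-sections of a strip with
no flux across its lateral sides does not depend on the height. -/
theorem integral_flux_eq_of_divergence_eq_zero {L : ℝ} (hL : 0 ≤ L) {U : Set (ℝ × ℝ)}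
    (hU : IsOpen U) (hUsub : Icc (0 : ℝ) L ×ˢ (univ : Set ℝ) ⊆ U) {f h : ℝ × ℝ → ℝ}
    (hf : ContDiffOn ℝ 1 f U) (hh : ContDiffOn ℝ 1 h U)
    (hf0 : ∀ z, f (0, z) = 0) (hfL : ∀ z, f (L, z) = 0)
    (hdiv : ∀ x ∈ Icc (0 : ℝ) L ×ˢ (univ : Set ℝ),
      fderiv ℝ f x (1, 0) + fderiv ℝ h x (0, 1) = 0) (a b : ℝ) :
    ∫ y in (0 : ℝ)..L, h (y, b) = ∫ y in (0 : ℝ)..L, h (y, a) := by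
  have hsub : uIcc (0 : ℝ) L ×ˢ uIcc a b ⊆ Icc (0 : ℝ) L ×ˢ (univ : Set ℝ) := by
    rw [uIcc_of_le hL]
    exact prod_mono_right (subset_univ _)
  have hmem : ∀ x ∈ Ioo (min 0 L) (max 0 L) ×ˢ Ioo (min a b) (max a b) \ (∅ : Set (ℝ × ℝ)),
      U ∈ nhds x := by
    rintro x ⟨⟨hx, -⟩, -⟩
    rw [min_eq_left hL, max_eq_right hL] at hx
    exact hU.mem_nhds (hUsub ⟨Ioo_subset_Icc_self hx, mem_univ _⟩)
  have key := integral2_divergence_prod_of_hasFDerivAt_off_countable f h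
    (fderiv ℝ f) (fderiv ℝ h) 0 a L b ∅ countable_empty
    (hf.continuousOn.mono (hsub.trans hUsub)) (hh.continuousOn.mono (hsub.trans hUsub))
    (fun x hx => ((hf.contDiffAt (hmem x hx)).differentiableAt one_ne_zero).hasFDerivAt)
    (fun x hx => ((hh.contDiffAt (hmem x hx)).differentiableAt one_ne_zero).hasFDerivAt)
    (integrableOn_zero.congr_fun (fun x hx => (hdiv x (hsub hx)).symm)
      (measurableSet_uIcc.prod measurableSet_uIcc))
  have hzero : (∫ y in (0 : ℝ)..L, ∫ z in a..b,
      fderiv ℝ f (y, z) (1, 0) + fderiv ℝ h (y, z) (0, 1)) = 0 := by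
    rw [intervalIntegral.integral_congr (g := fun _ => (0 : ℝ)), intervalIntegral.integral_zero]
    intro y hy
    rw [uIcc_of_le hL] at hy
    simp [hdiv _ (mk_mem_prod hy (mem_univ _))]
  simp only [hzero, hf0, hfL, intervalIntegral.integral_zero] at key
  linarith

/-- Bounded convergence for continuous functions on `[0, L]`. -/
theorem tendsto_integral_of_eventually_bounded {L : ℝ} (hL : 0 ≤ L) {l : Filter ℝ}
    [l.IsCountablyGenerated] {F : ℝ → ℝ → ℝ} {f : ℝ → ℝ} (C : ℝ)
    (hcont : ∀ z, ContinuousOn (F z) (Icc 0 L))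
    (hbound : ∀ᶠ z in l, ∀ y ∈ Icc 0 L, |F z y| ≤ C)
    (hlim : ∀ y ∈ Icc 0 L, Tendsto (fun z => F z y) l (nhds (f y))) :
    Tendsto (fun z => ∫ y in (0 : ℝ)..L, F z y) l (nhds (∫ y in (0 : ℝ)..L, f y)) := by
  have hsub : uIoc 0 L ⊆ Icc 0 L := by
    rw [uIoc_of_le hL]
    exact Ioc_subset_Icc_self
  refine intervalIntegral.tendsto_integral_filter_of_dominated_convergence (fun _ => C)
    (.of_forall fun z => ((hcont z).mono hsub).aestronglyMeasurable measurableSet_uIoc) ?_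
    intervalIntegrable_const (.of_forall fun y hy => hlim y (hsub hy))
  filter_upwards [hbound] with z hz
  exact .of_forall fun y hy => hz y (hsub hy)

/-- Wave-speed identity on the doubly infinite strip:
`c ∫₀^L (s*(y) − s_*) dy = F_∞ − k(s_*) g L`. -/
theorem wave_speed_identity
    (L c g τ Finf sStar : ℝ) (hL : 0 < L) (hc : 0 < c) (hg : 0 < g) (hτ : 0 < τ)
    (hsStar : sStar ∈ Ioo (0:ℝ) 1)
    (k : ℝ → ℝ) (hk : ContDiff ℝ 1 k)
    (pc : ℝ → ℝ) (hpc : ContinuousOn pc (Ioo (0:ℝ) 1))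
    (s p : ℝ × ℝ → ℝ) (U : Set (ℝ × ℝ)) (hU : IsOpen U)
    (hUsub : Icc (0:ℝ) L ×ˢ (univ : Set ℝ) ⊆ U)
    (hs : ContDiffOn ℝ 1 s U) (hp : ContDiffOn ℝ 2 p U)
    (hsRange : ∀ x ∈ Icc (0:ℝ) L ×ˢ (univ : Set ℝ), s x ∈ Ioo (0:ℝ) 1)
    (hRich : ∀ x ∈ Icc (0:ℝ) L ×ˢ (univ : Set ℝ),
      c * pdz s x =
        pdy (fun x' => k (s x') * pdy p x') x
          + pdz (fun x' => k (s x') * (pdz p x' + g)) x)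
    (hHys : ∀ x ∈ Icc (0:ℝ) L ×ˢ (univ : Set ℝ),
      c * τ * pdz s x = max (p x - pc (s x)) 0)
    (hNeu : ∀ z : ℝ, pdy p (0, z) = 0 ∧ pdy p (L, z) = 0)
    (hbot_s : TendstoUniformlyOn (fun z y => s (y, z)) (fun _ => sStar)
      atBot (Icc (0:ℝ) L))
    (hbot_p : TendstoUniformlyOn
      (fun z y => (k (s (y, z)) * pdy p (y, z), k (s (y, z)) * pdz p (y, z)))
      (fun _ => ((0:ℝ), (0:ℝ))) atBot (Icc (0:ℝ) L))
    (htop : Tendsto (fun z => ∫ y in (0:ℝ)..L, k (s (y, z)) * (pdz p (y, z) + g))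
      atTop (nhds Finf)) :
    ∃ sLim : ℝ → ℝ,
      (∀ y ∈ Icc (0:ℝ) L, Tendsto (fun z => s (y, z)) atTop (nhds (sLim y))) ∧
      c * (∫ y in (0:ℝ)..L, (sLim y - sStar)) = Finf - k sStar * g * L := by
  have hdiff {f : ℝ × ℝ → ℝ} (hf : ContDiffOn ℝ 1 f U) {x : ℝ × ℝ}
      (hx : x ∈ Icc (0:ℝ) L ×ˢ (univ : Set ℝ)) : DifferentiableAt ℝ f x :=
    (hf.contDiffAt (hU.mem_nhds (hUsub hx))).differentiableAt one_ne_zero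
  have hslice {f : ℝ × ℝ → ℝ} (hf : ContinuousOn f U) (z : ℝ) :
      ContinuousOn (fun y => f (y, z)) (Icc 0 L) :=
    hf.comp (by fun_prop) fun y hy => hUsub ⟨hy, mem_univ _⟩
  have hks : ContDiffOn ℝ 1 (fun x => k (s x)) U := hk.comp_contDiffOn hs
  have hF₁ : ContDiffOn ℝ 1 (fun x => k (s x) * pdy p x) U := hks.mul (hp.pdy hU)
  have hF₂ : ContDiffOn ℝ 1 (fun x => k (s x) * (pdz p x + g)) U :=
    hks.mul ((hp.pdz hU).add contDiffOn_const)
  have hcs : ContDiffOn ℝ 1 (fun x => c * (s x - sStar)) U :=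
    contDiffOn_const.mul (hs.sub contDiffOn_const)
  have hmono : ∀ y ∈ Icc (0:ℝ) L, Monotone fun z => s (y, z) := by
    intro y hy
    have hd (z : ℝ) := hasDerivAt_pdz (hdiff hs (x := (y, z)) ⟨hy, mem_univ _⟩)
    refine monotone_of_deriv_nonneg (fun z => (hd z).differentiableAt) fun z => ?_
    have h0 : 0 ≤ c * τ * pdz s (y, z) := by
      rw [hHys (y, z) ⟨hy, mem_univ _⟩]
      exact le_max_right _ _
    exact nonneg_of_mul_nonneg_right h0 (mul_pos hc hτ)
  have hlim : ∀ y ∈ Icc (0:ℝ) L,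
      Tendsto (fun z => s (y, z)) atTop (nhds (⨆ z, s (y, z))) := by
    refine fun y hy => tendsto_atTop_ciSup (hmono y hy) ⟨1, ?_⟩
    rintro _ ⟨z, rfl⟩
    exact (hsRange (y, z) ⟨hy, mem_univ _⟩).2.le
  refine ⟨fun y => ⨆ z, s (y, z), hlim, ?_⟩
  set sLim : ℝ → ℝ := fun y => ⨆ z, s (y, z)
  have hconst (z : ℝ) :=
    integral_flux_eq_of_divergence_eq_zero hL.le hU hUsub hF₁ (hF₂.sub hcs)
      (fun z => by simp [(hNeu z).1]) (fun z => by simp [(hNeu z).2])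
      (fun x hx => by
        have h₁ := pdy_eq_fderiv (hdiff hF₁ hx)
        have h₂ := pdz_eq_fderiv (hdiff hF₂ hx)
        have h₃ := pdz_eq_fderiv (hdiff hs hx)
        have h₄ : fderiv ℝ (fun x => c * (s x - sStar)) x = c • fderiv ℝ s x := by
          rw [fderiv_const_mul ((hdiff hs hx).sub_const _), fderiv_sub_const]
        have h₅ : fderiv ℝ (fun x => k (s x) * (pdz p x + g) - c * (s x - sStar)) x =
            fderiv ℝ (fun x => k (s x) * (pdz p x + g)) x
              - fderiv ℝ (fun x => c * (s x - sStar)) x :=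
          fderiv_fun_sub (hdiff hF₂ hx) (hdiff hcs hx)
        have h₆ := hRich x hx
        rw [h₅, h₄, ← h₁, sub_apply, smul_apply,
          ← h₂, ← h₃, smul_eq_mul]
        linarith) z 0
  have hsint (z : ℝ) : ∀ y ∈ Icc (0:ℝ) L, |s (y, z) - sStar| ≤ 1 := by
    intro y hy
    have h := hsRange (y, z) ⟨hy, mem_univ _⟩
    rw [abs_le]
    constructor <;> linarith [hsStar.1, hsStar.2, h.1, h.2]
  have htopInt : Tendsto (fun z => ∫ y in (0:ℝ)..L,
      (k (s (y, z)) * (pdz p (y, z) + g) - c * (s (y, z) - sStar))) atTop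
      (nhds (Finf - c * ∫ y in (0:ℝ)..L, (sLim y - sStar))) := by
    have hS := tendsto_integral_of_eventually_bounded hL.le 1
      (hslice (hs.continuousOn.sub continuousOn_const))
      (.of_forall fun z => hsint z) (fun y hy => (hlim y hy).sub_const sStar)
    refine (htop.sub (hS.const_mul c)).congr fun z => ?_
    rw [← intervalIntegral.integral_const_mul]
    exact (intervalIntegral.integral_sub
      ((hslice hF₂.continuousOn z).intervalIntegrable_of_Icc hL.le)
      ((hslice hcs.continuousOn z).intervalIntegrable_of_Icc hL.le)).symm
  have hbotInt : Tendsto (fun z => ∫ y in (0:ℝ)..L,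
      (k (s (y, z)) * (pdz p (y, z) + g) - c * (s (y, z) - sStar))) atBot
      (nhds (∫ y in (0:ℝ)..L, k sStar * g)) := by
    obtain ⟨K, hK⟩ := isCompact_Icc.exists_bound_of_continuousOn
      (hk.continuous.continuousOn (s := Icc (0:ℝ) 1))
    refine tendsto_integral_of_eventually_bounded hL.le (1 + K * g + c * 1)
      (hslice (hF₂.sub hcs).continuousOn) ?_ fun y hy => ?_
    · filter_upwards [Metric.tendstoUniformlyOn_iff.1 hbot_p 1 one_pos] with z hz y hy
      have h₁ : |k (s (y, z)) * pdz p (y, z)| ≤ 1 := by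
        have h := hz y hy
        rw [dist_comm, Prod.dist_eq, max_lt_iff, Real.dist_eq, Real.dist_eq, sub_zero,
          sub_zero] at h
        exact h.2.le
      have h₂ : |k (s (y, z)) * g| ≤ K * g := by
        rw [abs_mul, abs_of_pos hg]
        exact mul_le_mul_of_nonneg_right
          (hK _ (Ioo_subset_Icc_self (hsRange (y, z) ⟨hy, mem_univ _⟩))) hg.le
      have h₃ : |c * (s (y, z) - sStar)| ≤ c * 1 := by
        rw [abs_mul, abs_of_pos hc]
        exact mul_le_mul_of_nonneg_left (hsint z y hy) hc.le
      rw [mul_add]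
      exact (abs_sub _ _).trans (add_le_add ((abs_add_le _ _).trans (add_le_add h₁ h₂)) h₃)
    · have h₁ := hbot_s.tendsto_at hy
      have h₂ := ((continuous_snd.tendsto _).comp (hbot_p.tendsto_at hy))
      have h₃ := (h₂.add (((hk.continuous.tendsto _).comp h₁).mul_const g)).sub
        ((h₁.sub_const sStar).const_mul c)
      simp only [sub_self, mul_zero, sub_zero, zero_add] at h₃
      refine h₃.congr fun z => ?_
      simp only [Function.comp_apply]
      ring
  have e₁ := tendsto_nhds_unique htopInt (tendsto_const_nhds.congr fun z => (hconst z))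
  have e₂ := tendsto_nhds_unique hbotInt (tendsto_const_nhds.congr fun z => (hconst z))
  rw [intervalIntegral.integral_const, smul_eq_mul, sub_zero] at e₂
  linarith
end

section
/- Let L, H, c, τ, ρ, C_P > 0 and let p_c : (0,1) → ℝ be differentiable with p_c'(s) ≥ ρ for all s ∈ (0,1). Let s be C² and p be C¹ on an open set containing [0,L] × [0,H], with 0 < s < 1, with |∇p(x)| ≤ C_P for every x ∈ [0,L] × [0,H], and satisfying the hysteresis relation c τ ∂_z s = max(p − p_c(s), 0) at every point. Set s₀(y) := s(y,0), p₀(y) := p(y,0), and C_s := C_P/ρ + sup_{y∈[0,L]} |∂_y s₀(y)| + (1/(cτ)) sup_{y∈[0,L]} max(p₀(y) − p_c(s₀(y)), 0). Then |∂_z s(x)| ≤ C_s and |∂_y s(x)| ≤ C_s for every x ∈ [0,L] × [0,H]. -/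
open MeasureTheory Set Filter

/-- A barrier principle: a function that starts below `M` and does not increase while it exceeds
`M` stays below `M`. -/
theorem le_of_hasDerivAt_nonpos_of_lt {f f' : ℝ → ℝ} {b M : ℝ} (hf : ContinuousOn f (Icc 0 b))
    (hd : ∀ z ∈ Ioo 0 b, HasDerivAt f (f' z) z) (h0 : f 0 ≤ M)
    (hneg : ∀ z ∈ Ioo 0 b, M < f z → f' z ≤ 0) : ∀ z ∈ Icc 0 b, f z ≤ M := by
  intro z₁ hz₁
  by_contra! hlt
  have hsub : Icc 0 z₁ ⊆ Icc 0 b := Icc_subset_Icc_right hz₁.2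
  have hcomp : IsCompact (Icc 0 z₁ ∩ f ⁻¹' Iic M) :=
    isCompact_Icc.of_isClosed_subset
      ((hf.mono hsub).preimage_isClosed_of_isClosed isClosed_Icc isClosed_Iic) inter_subset_left
  obtain ⟨z₀, ⟨hz₀, hfz₀⟩, hmax⟩ := hcomp.exists_isGreatest ⟨0, ⟨le_rfl, hz₁.1⟩, h0⟩
  have hanti : AntitoneOn f (Icc z₀ z₁) := by
    refine antitoneOn_of_hasDerivWithinAt_nonpos (f' := f') (convex_Icc z₀ z₁)
      (hf.mono (Icc_subset_Icc hz₀.1 hz₁.2)) ?_ ?_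
    · intro x hx
      rw [interior_Icc] at hx
      exact (hd x ⟨hz₀.1.trans_lt hx.1, hx.2.trans_le hz₁.2⟩).hasDerivWithinAt
    · intro x hx
      rw [interior_Icc] at hx
      refine hneg x ⟨hz₀.1.trans_lt hx.1, hx.2.trans_le hz₁.2⟩ ?_
      by_contra! hle
      exact absurd (hmax ⟨⟨hz₀.1.trans hx.1.le, hx.2.le⟩, hle⟩) (not_le.2 hx.1)
  have h := hanti (left_mem_Icc.2 hz₀.2) (right_mem_Icc.2 hz₀.2) hz₀.2
  exact absurd (h.trans hfz₀) (not_le.2 hlt)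

section PartialDerivatives

variable {F : Type*} [NormedAddCommGroup F] [NormedSpace ℝ F]

theorem DifferentiableAt.hasDerivAt_slice_fst {f : ℝ × ℝ → F} {y z : ℝ}
    (hf : DifferentiableAt ℝ f (y, z)) :
    HasDerivAt (fun t => f (t, z)) (fderiv ℝ f (y, z) (1, 0)) y :=
  hf.hasFDerivAt.comp_hasDerivAt y ((hasDerivAt_id y).prodMk (hasDerivAt_const y z))

theorem DifferentiableAt.hasDerivAt_slice_snd {f : ℝ × ℝ → F} {y z : ℝ}
    (hf : DifferentiableAt ℝ f (y, z)) :
    HasDerivAt (fun t => f (y, t)) (fderiv ℝ f (y, z) (0, 1)) z :=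
  hf.hasFDerivAt.comp_hasDerivAt z ((hasDerivAt_const z y).prodMk (hasDerivAt_id z))

end PartialDerivatives

/-- Lipschitz continuity of the saturation: both `|∂_z s|` and `|∂_y s|` are bounded by
`C_s = C_P/ρ + sup |∂_y s₀| + (1/(cτ)) sup [p₀ − p_c(s₀)]₊`. -/
theorem saturation_lipschitz_bound
    (L H c τ ρ CP : ℝ) (hL : 0 < L) (hH : 0 < H) (hc : 0 < c)
    (hτ : 0 < τ) (hρ : 0 < ρ) (hCP : 0 < CP)
    (pc pc' : ℝ → ℝ)
    (hpc : ∀ σ ∈ Ioo (0:ℝ) 1, HasDerivAt pc (pc' σ) σ)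
    (hpc' : ∀ σ ∈ Ioo (0:ℝ) 1, ρ ≤ pc' σ)
    (s p : ℝ × ℝ → ℝ) (U : Set (ℝ × ℝ)) (hU : IsOpen U)
    (hUsub : Icc (0:ℝ) L ×ˢ Icc (0:ℝ) H ⊆ U)
    (hs : ContDiffOn ℝ 2 s U) (hp : ContDiffOn ℝ 1 p U)
    (hsRange : ∀ x ∈ Icc (0:ℝ) L ×ˢ Icc (0:ℝ) H, s x ∈ Ioo (0:ℝ) 1)
    (hgradp : ∀ x ∈ Icc (0:ℝ) L ×ˢ Icc (0:ℝ) H,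
      Real.sqrt ((pdy p x) ^ 2 + (pdz p x) ^ 2) ≤ CP)
    (hHys : ∀ x ∈ Icc (0:ℝ) L ×ˢ Icc (0:ℝ) H,
      c * τ * pdz s x = max (p x - pc (s x)) 0) :
    ∀ x ∈ Icc (0:ℝ) L ×ˢ Icc (0:ℝ) H,
      |pdz s x| ≤ CP / ρ
          + sSup ((fun y => |pdy s (y, 0)|) '' Icc (0:ℝ) L)
          + (1 / (c * τ)) * sSup ((fun y => max (p (y, 0) - pc (s (y, 0))) 0) '' Icc (0:ℝ) L)
        ∧
      |pdy s x| ≤ CP / ρ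
          + sSup ((fun y => |pdy s (y, 0)|) '' Icc (0:ℝ) L)
          + (1 / (c * τ)) * sSup ((fun y => max (p (y, 0) - pc (s (y, 0))) 0) '' Icc (0:ℝ) L) := by
  have hcτ : 0 < c * τ := mul_pos hc hτ
  have hsd : ∀ x ∈ U, DifferentiableAt ℝ s x := fun x hx =>
    (hs.contDiffAt (hU.mem_nhds hx)).differentiableAt (by norm_num)
  have hpd : ∀ x ∈ U, DifferentiableAt ℝ p x := fun x hx =>
    (hp.contDiffAt (hU.mem_nhds hx)).differentiableAt (by norm_num)
  have hDs : ContDiffOn ℝ 1 (fderiv ℝ s) U := hs.fderiv_of_isOpen hU (by norm_num)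
  have hDsd : ∀ x ∈ U, DifferentiableAt ℝ (fderiv ℝ s) x := fun x hx =>
    (hDs.contDiffAt (hU.mem_nhds hx)).differentiableAt (by norm_num)
  have hsymm : ∀ x ∈ U, fderiv ℝ (fderiv ℝ s) x (1, 0) (0, 1)
      = fderiv ℝ (fderiv ℝ s) x (0, 1) (1, 0) := fun x hx =>
    ((hs.contDiffAt (hU.mem_nhds hx)).isSymmSndFDerivAt (by simp)) _ _
  have hpy : ∀ x ∈ Icc (0:ℝ) L ×ˢ Icc (0:ℝ) H, |fderiv ℝ p x (1, 0)| ≤ CP := fun x hx => by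
    rw [← pdy_eq_fderiv (hpd x (hUsub hx))]
    exact (Real.abs_le_sqrt (le_add_of_nonneg_right (sq_nonneg _))).trans (hgradp x hx)
  have hpz : ∀ x ∈ Icc (0:ℝ) L ×ˢ Icc (0:ℝ) H, |fderiv ℝ p x (0, 1)| ≤ CP := fun x hx => by
    rw [← pdz_eq_fderiv (hpd x (hUsub hx))]
    exact (Real.abs_le_sqrt (le_add_of_nonneg_left (sq_nonneg _))).trans (hgradp x hx)
  have hHys' : ∀ x ∈ Icc (0:ℝ) L ×ˢ Icc (0:ℝ) H,
      c * τ * fderiv ℝ s x (0, 1) = max (p x - pc (s x)) 0 := fun x hx => by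
    rw [← pdz_eq_fderiv (hsd x (hUsub hx)), hHys x hx]
  have hgcont : ContinuousOn (fun x => p x - pc (s x)) (Icc (0:ℝ) L ×ˢ Icc (0:ℝ) H) :=
    fun x hx => ((hpd x (hUsub hx)).continuousAt.sub
      ((hpc _ (hsRange x hx)).continuousAt.comp
        (hsd x (hUsub hx)).continuousAt)).continuousWithinAt
  have hgy : ∀ y z, (y, z) ∈ Icc (0:ℝ) L ×ˢ Icc (0:ℝ) H →
      HasDerivAt (fun t => p (t, z) - pc (s (t, z)))
        (fderiv ℝ p (y, z) (1, 0) - pc' (s (y, z)) * fderiv ℝ s (y, z) (1, 0)) y :=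
    fun y z hx => (hpd _ (hUsub hx)).hasDerivAt_slice_fst.sub
      ((hpc _ (hsRange _ hx)).comp y (hsd _ (hUsub hx)).hasDerivAt_slice_fst)
  have hgz : ∀ y z, (y, z) ∈ Icc (0:ℝ) L ×ˢ Icc (0:ℝ) H →
      HasDerivAt (fun t => p (y, t) - pc (s (y, t)))
        (fderiv ℝ p (y, z) (0, 1) - pc' (s (y, z)) * fderiv ℝ s (y, z) (0, 1)) z :=
    fun y z hx => (hpd _ (hUsub hx)).hasDerivAt_slice_snd.sub
      ((hpc _ (hsRange _ hx)).comp z (hsd _ (hUsub hx)).hasDerivAt_slice_snd)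
  have hsy : ContinuousOn (fun x => pdy s x) (Icc (0:ℝ) L ×ˢ Icc (0:ℝ) H) := by
    refine ContinuousOn.congr (f := fun x => fderiv ℝ s x (1, 0)) ?_
      (fun x hx => pdy_eq_fderiv (hsd x (hUsub hx)))
    exact (hDs.continuousOn.mono hUsub).clm_apply continuousOn_const
  have hslice_y : ∀ z ∈ Icc (0:ℝ) H,
      MapsTo (fun y => (y, z)) (Icc (0:ℝ) L) (Icc (0:ℝ) L ×ˢ Icc (0:ℝ) H) :=
    fun z hz y hy => ⟨hy, hz⟩
  have hslice_z : ∀ y ∈ Icc (0:ℝ) L,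
      MapsTo (fun z => (y, z)) (Icc (0:ℝ) H) (Icc (0:ℝ) L ×ˢ Icc (0:ℝ) H) :=
    fun y hy z hz => ⟨hy, hz⟩
  have h0H : (0:ℝ) ∈ Icc (0:ℝ) H := ⟨le_rfl, hH.le⟩
  set A := sSup ((fun y => |pdy s (y, 0)|) '' Icc (0:ℝ) L) with hA
  set B := sSup ((fun y => max (p (y, 0) - pc (s (y, 0))) 0) '' Icc (0:ℝ) L) with hB
  have hA_le : ∀ y ∈ Icc (0:ℝ) L, |pdy s (y, 0)| ≤ A := fun y hy =>
    le_csSup (isCompact_Icc.bddAbove_image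
      (hsy.comp (by fun_prop) (hslice_y 0 h0H)).abs) (mem_image_of_mem _ hy)
  have hB_le : ∀ y ∈ Icc (0:ℝ) L, max (p (y, 0) - pc (s (y, 0))) 0 ≤ B := fun y hy =>
    le_csSup (isCompact_Icc.bddAbove_image
      ((hgcont.comp (by fun_prop) (hslice_y 0 h0H)).sup continuousOn_const))
      (mem_image_of_mem (fun y => max (p (y, 0) - pc (s (y, 0))) 0) hy)
  have h0L : (0:ℝ) ∈ Icc (0:ℝ) L := ⟨le_rfl, hL.le⟩
  have hA0 : 0 ≤ A := (abs_nonneg _).trans (hA_le 0 h0L)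
  have hB0 : 0 ≤ B := (le_max_right _ _).trans (hB_le 0 h0L)
  have hK0 : 0 < CP / ρ := div_pos hCP hρ
  have hBc : 0 ≤ 1 / (c * τ) * B := by positivity
  -- The overpressure cannot grow once it exceeds `c τ C_P / ρ`.
  have hz_bound : ∀ y ∈ Icc (0:ℝ) L, ∀ z ∈ Icc (0:ℝ) H,
      p (y, z) - pc (s (y, z)) ≤ c * τ * (CP / ρ) + B := by
    intro y hy
    refine le_of_hasDerivAt_nonpos_of_lt
      (hgcont.comp (by fun_prop) (hslice_z y hy))
      (fun z hz => hgz y z ⟨hy, Ioo_subset_Icc_self hz⟩) ?_ ?_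
    · have h := (le_max_left _ _).trans (hB_le y hy)
      have : 0 ≤ c * τ * (CP / ρ) := by positivity
      linarith
    · intro z hz hlt
      have hx : (y, z) ∈ Icc (0:ℝ) L ×ˢ Icc (0:ℝ) H := ⟨hy, Ioo_subset_Icc_self hz⟩
      have h1 := hHys' _ hx
      have h2 := (abs_le.1 (hpz _ hx)).2
      have h3 := hpc' _ (hsRange _ hx)
      have h4 : c * τ * (CP / ρ) < c * τ * fderiv ℝ s (y, z) (0, 1) := by
        rw [h1]
        exact lt_max_of_lt_left (by linarith)
      have h5 : CP / ρ < fderiv ℝ s (y, z) (0, 1) := lt_of_mul_lt_mul_left h4 hcτ.le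
      have h6 : CP < fderiv ℝ s (y, z) (0, 1) * ρ := (div_lt_iff₀ hρ).1 h5
      nlinarith [mul_le_mul_of_nonneg_right h3 (hK0.trans h5).le]
  -- The equation for `∂_y s`, obtained by differentiating the hysteresis relation in `y`.
  have hw : ∀ y ∈ Ioo (0:ℝ) L, ∀ z ∈ Icc (0:ℝ) H,
      fderiv ℝ (fderiv ℝ s) (y, z) (0, 1) (1, 0) = 0 ∨
      c * τ * fderiv ℝ (fderiv ℝ s) (y, z) (0, 1) (1, 0)
        = fderiv ℝ p (y, z) (1, 0) - pc' (s (y, z)) * fderiv ℝ s (y, z) (1, 0) := by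
    intro y hy z hz
    have hx : (y, z) ∈ Icc (0:ℝ) L ×ˢ Icc (0:ℝ) H := ⟨Ioo_subset_Icc_self hy, hz⟩
    rw [← hsymm _ (hUsub hx)]
    have hD : HasDerivAt (fun t => c * τ * fderiv ℝ s (t, z) (0, 1))
        (c * τ * fderiv ℝ (fderiv ℝ s) (y, z) (1, 0) (0, 1)) y := by
      have h := ((hDsd _ (hUsub hx)).hasDerivAt_slice_fst.clm_apply
        (hasDerivAt_const y ((0:ℝ), (1:ℝ)))).const_mul (c * τ)
      simpa using h
    have hev : ∀ᶠ t in nhds y, c * τ * fderiv ℝ s (t, z) (0, 1)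
        = max (p (t, z) - pc (s (t, z))) 0 := by
      filter_upwards [Ioo_mem_nhds hy.1 hy.2] with t ht
      exact hHys' _ ⟨Ioo_subset_Icc_self ht, hz⟩
    rcases le_or_gt (p (y, z) - pc (s (y, z))) 0 with hle | hgt
    · left
      have hmin : IsLocalMin (fun t => c * τ * fderiv ℝ s (t, z) (0, 1)) y := by
        filter_upwards [hev] with t ht
        rw [ht, hHys' _ hx, max_eq_right hle]
        exact le_max_right _ _
      exact (mul_eq_zero.1 (hmin.hasDerivAt_eq_zero hD)).resolve_left hcτ.ne'
    · right
      have hg := hgy y z hx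
      refine hD.unique (hg.congr_of_eventuallyEq ?_)
      filter_upwards [hev, hg.continuousAt.eventually_const_lt hgt] with t ht htpos
      rw [ht, max_eq_left htpos.le]
  have hwz : ∀ y ∈ Icc (0:ℝ) L, ∀ z ∈ Icc (0:ℝ) H,
      HasDerivAt (fun t => fderiv ℝ s (y, t) (1, 0))
        (fderiv ℝ (fderiv ℝ s) (y, z) (0, 1) (1, 0)) z := by
    intro y hy z hz
    have h := (hDsd _ (hUsub ⟨hy, hz⟩)).hasDerivAt_slice_snd.clm_apply
      (hasDerivAt_const z ((1:ℝ), (0:ℝ)))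
    simpa using h
  have hy_bound : ∀ y ∈ Ioo (0:ℝ) L, ∀ z ∈ Icc (0:ℝ) H, |pdy s (y, z)| ≤ CP / ρ + A := by
    intro y hy z hz
    have hy' := Ioo_subset_Icc_self hy
    have hcont : ContinuousOn (fun t => fderiv ℝ s (y, t) (1, 0)) (Icc 0 H) :=
      fun t ht => (hwz y hy' t ht).continuousAt.continuousWithinAt
    have hinit := hA_le y hy'
    rw [pdy_eq_fderiv (hsd _ (hUsub ⟨hy', h0H⟩)), abs_le] at hinit
    have hup := le_of_hasDerivAt_nonpos_of_lt (M := CP / ρ + A) hcont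
      (fun t ht => hwz y hy' t (Ioo_subset_Icc_self ht)) (by linarith [hinit.2]) ?_ z hz
    · have hdown := le_of_hasDerivAt_nonpos_of_lt (M := CP / ρ + A) hcont.neg
        (fun t ht => (hwz y hy' t (Ioo_subset_Icc_self ht)).neg)
        (by simp only [Pi.neg_apply]; linarith [hinit.1]) ?_ z hz
      · rw [pdy_eq_fderiv (hsd _ (hUsub ⟨hy', hz⟩)), abs_le]
        simp only [Pi.neg_apply] at hdown
        exact ⟨by linarith, hup⟩
      · intro t ht hlt
        simp only [Pi.neg_apply] at hlt
        have ht' := Ioo_subset_Icc_self ht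
        rcases hw y hy t ht' with h | h
        · rw [h, neg_zero]
        · have h2 := (abs_le.1 (hpy (y, t) ⟨hy', ht'⟩)).1
          have h3 := hpc' _ (hsRange (y, t) ⟨hy', ht'⟩)
          have h5 : CP / ρ < -fderiv ℝ s (y, t) (1, 0) := by linarith
          have h6 := (div_lt_iff₀ hρ).1 h5
          have h7 := mul_le_mul_of_nonneg_right h3 (hK0.trans h5).le
          have h8 : 0 ≤ c * τ * fderiv ℝ (fderiv ℝ s) (y, t) (0, 1) (1, 0) := by
            rw [h]; linarith
          exact neg_nonpos.2 (nonneg_of_mul_nonneg_right h8 hcτ)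
    · intro t ht hlt
      have ht' := Ioo_subset_Icc_self ht
      rcases hw y hy t ht' with h | h
      · exact h.le
      · have h2 := (abs_le.1 (hpy (y, t) ⟨hy', ht'⟩)).2
        have h3 := hpc' _ (hsRange (y, t) ⟨hy', ht'⟩)
        have h5 : CP / ρ < fderiv ℝ s (y, t) (1, 0) := by linarith
        have h6 := (div_lt_iff₀ hρ).1 h5
        have h7 := mul_le_mul_of_nonneg_right h3 (hK0.trans h5).le
        have h8 : c * τ * fderiv ℝ (fderiv ℝ s) (y, t) (0, 1) (1, 0) ≤ 0 := by
          rw [h]; linarith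
        exact nonpos_of_mul_nonpos_right h8 hcτ
  rintro ⟨y, z⟩ hx
  obtain ⟨hy, hz⟩ : y ∈ Icc (0:ℝ) L ∧ z ∈ Icc (0:ℝ) H := hx
  constructor
  · have h1 := hHys (y, z) ⟨hy, hz⟩
    have h2 : 0 ≤ pdz s (y, z) :=
      nonneg_of_mul_nonneg_right (h1 ▸ le_max_right _ _) hcτ
    have h3 : c * τ * pdz s (y, z) ≤ c * τ * (CP / ρ) + B := by
      rw [h1]
      exact max_le (hz_bound y hy z hz) (by positivity)
    have h4 : c * τ * (CP / ρ) + B = c * τ * (CP / ρ + 1 / (c * τ) * B) := by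
      field_simp
    rw [h4] at h3
    rw [abs_of_nonneg h2]
    linarith [le_of_mul_le_mul_left h3 hcτ]
  · have hcl : closure (Ioo (0:ℝ) L) = Icc 0 L := closure_Ioo hL.ne
    have h := le_on_closure (s := Ioo (0:ℝ) L) (f := fun t => |pdy s (t, z)|)
      (g := fun _ => CP / ρ + A) (fun t ht => hy_bound t ht z hz)
      (by rw [hcl]; exact (hsy.comp (by fun_prop) (hslice_y z hz)).abs)
      continuousOn_const (hcl ▸ hy)
    exact h.trans (le_add_of_nonneg_right hBc)
end

section
/- Let H, c, τ > 0, let p_c : (0,1) → ℝ be continuous and strictly increasing with p_c(s) → +∞ as s → 1⁻, and let p̄ ∈ ℝ and s̄ ∈ (0,1) be such that p_c(s) > p̄ for all s ∈ (s̄, 1). Let p : [0,H] → ℝ be continuous with p(z) ≤ p̄ for all z, and let s : [0,H] → (0,1) be differentiable with c τ s'(z) = max(p(z) − p_c(s(z)), 0) for all z and s(0) = s₀. Then s is nondecreasing on [0,H] and s(z) ≤ max(s₀, s̄) for all z ∈ [0,H]; in particular s stays bounded away from 1. -/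
open Set Filter

/-- The hysteresis ODE `cτ s' = [p − p_c(s)]₊` with bounded pressure input keeps the
saturation nondecreasing and bounded away from `1`. -/
theorem hysteresis_ode_bound
    (H c τ : ℝ) (hH : 0 < H) (hc : 0 < c) (hτ : 0 < τ)
    (pc : ℝ → ℝ) (hpcCont : ContinuousOn pc (Ioo (0:ℝ) 1))
    (hpcMono : StrictMonoOn pc (Ioo (0:ℝ) 1))
    (hpcTop : Tendsto pc (nhdsWithin 1 (Iio (1:ℝ))) atTop)
    (pBar sBar : ℝ) (hsBar : sBar ∈ Ioo (0:ℝ) 1)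
    (hpcAbove : ∀ σ ∈ Ioo sBar 1, pBar < pc σ)
    (p : ℝ → ℝ) (hp : ContinuousOn p (Icc (0:ℝ) H))
    (hpBar : ∀ z ∈ Icc (0:ℝ) H, p z ≤ pBar)
    (s s' : ℝ → ℝ) (s₀ : ℝ)
    (hsRange : ∀ z ∈ Icc (0:ℝ) H, s z ∈ Ioo (0:ℝ) 1)
    (hsDeriv : ∀ z ∈ Icc (0:ℝ) H, HasDerivWithinAt s (s' z) (Icc (0:ℝ) H) z)
    (hODE : ∀ z ∈ Icc (0:ℝ) H, c * τ * s' z = max (p z - pc (s z)) 0)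
    (hs0 : s 0 = s₀) :
    MonotoneOn s (Icc (0:ℝ) H) ∧ ∀ z ∈ Icc (0:ℝ) H, s z ≤ max s₀ sBar := by
  have hcτ : 0 < c * τ := mul_pos hc hτ
  have hcont : ContinuousOn s (Icc 0 H) := fun z hz ↦ (hsDeriv z hz).continuousWithinAt
  refine ⟨monotoneOn_of_hasDerivWithinAt_nonneg (f' := s') (convex_Icc 0 H) hcont
    (fun z hz ↦ (hsDeriv z (interior_subset hz)).mono interior_subset) fun z hz ↦ ?_, ?_⟩
  · refine nonneg_of_mul_nonneg_right ?_ hcτ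
    rw [hODE z (interior_subset hz)]
    exact le_max_right _ _
  have hderiv_zero : ∀ z ∈ Icc 0 H, sBar < s z → s' z = 0 := fun z hz hlt ↦ by
    have hneg : p z - pc (s z) ≤ 0 := by
      linarith [hpBar z hz, hpcAbove (s z) ⟨hlt, (hsRange z hz).2⟩]
    have h := hODE z hz
    rw [max_eq_right hneg] at h
    exact (mul_eq_zero.mp h).resolve_left hcτ.ne'
  -- Compare with the strictly increasing barrier `max s₀ sBar + ε (1 + z)`, then let `ε → 0`.
  have hbarrier : ∀ ε > 0, ∀ z ∈ Icc 0 H, s z ≤ max s₀ sBar + ε * (1 + z) := fun ε hε z hz ↦ by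
    refine image_le_of_deriv_right_lt_deriv_boundary (f' := s')
      (B := fun x ↦ max s₀ sBar + ε * (1 + x)) (B' := fun _ ↦ ε) hcont
      (fun x hx ↦ (hsDeriv x (Ico_subset_Icc_self hx)).mono_of_mem_nhdsWithin
        (Icc_mem_nhdsGE_of_mem hx)) ?_ (fun x ↦ ?_) (fun x hx heq ↦ ?_) hz
    · rw [hs0]
      linarith [le_max_left s₀ sBar]
    · simpa using (((hasDerivAt_id x).const_add 1).const_mul ε).const_add (max s₀ sBar)
    · have hpos : 0 < ε * (1 + x) := mul_pos hε (by linarith [hx.1])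
      rw [hderiv_zero x (Ico_subset_Icc_self hx) (by linarith [le_max_right s₀ sBar])]
      exact hε
  intro z hz
  refine le_of_forall_pos_le_add fun δ hδ ↦ ?_
  have hz1 : 0 < 1 + z := by linarith [hz.1]
  simpa [div_mul_cancel₀ δ hz1.ne'] using hbarrier (δ / (1 + z)) (div_pos hδ hz1) z hz
end

section
/- Let H, c, τ > 0 and let p_c : (0,1) → ℝ be continuous and nondecreasing. Let p₁, p₂ : [0,H] → ℝ be continuous and let s₁, s₂ : [0,H] → (0,1) be differentiable with c τ s_i'(z) = max(p_i(z) − p_c(s_i(z)), 0) for all z ∈ [0,H] and i = 1,2. Then for every z ∈ [0,H]: |s₁(z) − s₂(z)| ≤ |s₁(0) − s₂(0)| + (1/(cτ)) ∫₀^z |p₁(ζ) − p₂(ζ)| dζ. -/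
open Set Filter

/-- Comparison principle: if `f 0 ≤ a` and the right derivative of `f` is at most the continuous
function `g` wherever `f` is nonnegative, then `f` stays below `a + ∫ g`. -/
theorem le_add_integral_of_deriv_right_le {f f' g : ℝ → ℝ} {a H : ℝ} (ha : 0 ≤ a)
    (hg : ContinuousOn g (Icc 0 H)) (hg₀ : ∀ x ∈ Icc 0 H, 0 ≤ g x)
    (hf : ∀ x ∈ Icc 0 H, HasDerivWithinAt f (f' x) (Icc 0 H) x) (hf₀ : f 0 ≤ a)
    (hfg : ∀ x ∈ Icc 0 H, 0 ≤ f x → f' x ≤ g x) :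
    ∀ z ∈ Icc 0 H, f z ≤ a + ∫ t in (0:ℝ)..z, g t := by
  intro z hz
  have hH : (0:ℝ) ≤ H := hz.1.trans hz.2
  have hgi : ∀ x ∈ Icc 0 H, IntervalIntegrable g MeasureTheory.volume 0 x := fun x hx =>
    (hg.mono (Icc_subset_Icc_right hx.2)).intervalIntegrable_of_Icc hx.1
  have hcont : ContinuousOn (fun x => ∫ t in (0:ℝ)..x, g t) (Icc 0 H) := by
    simpa only [uIcc_of_le hH] using
      intervalIntegral.continuousOn_primitive_interval' (hgi H ⟨hH, le_rfl⟩) left_mem_uIcc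
  have key : ∀ ε : ℝ, 0 < ε → f z ≤ a + (∫ t in (0:ℝ)..z, g t) + ε * z := by
    intro ε hε
    refine image_le_of_deriv_right_lt_deriv_boundary' (f' := f')
      (B := fun x => a + (∫ t in (0:ℝ)..x, g t) + ε * x) (B' := fun x => g x + ε)
      (fun x hx => (hf x hx).continuousWithinAt) ?_ (by simpa using hf₀) ?_ ?_ ?_ hz
    · intro x hx
      exact (hf x (Ico_subset_Icc_self hx)).mono_of_mem_nhdsWithin (Icc_mem_nhdsGE_of_mem hx)
    · exact (continuousOn_const.add hcont).add (continuousOn_const.mul continuousOn_id)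
    · intro x hx
      have hmem : Icc 0 H ∈ nhdsWithin x (Ioi x) := Icc_mem_nhdsGT_of_mem hx
      have hd : HasDerivWithinAt (fun y => ∫ t in (0:ℝ)..y, g t) (g x) (Ici x) x :=
        intervalIntegral.integral_hasDerivWithinAt_right (hgi x (Ico_subset_Icc_self hx))
          ⟨Icc 0 H, hmem, hg.aestronglyMeasurable measurableSet_Icc⟩
          ((hg x (Ico_subset_Icc_self hx)).mono_of_mem_nhdsWithin hmem)
      simpa using (hd.const_add a).fun_add ((hasDerivWithinAt_id x (Ici x)).const_mul ε)
    · intro x hx hfx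
      have hx' := Ico_subset_Icc_self hx
      have hint : 0 ≤ ∫ t in (0:ℝ)..x, g t :=
        intervalIntegral.integral_nonneg hx.1 fun t ht => hg₀ t ⟨ht.1, ht.2.trans hx'.2⟩
      have hfx₀ : 0 ≤ f x := by
        rw [hfx]
        have := mul_nonneg hε.le hx.1
        positivity
      linarith [hfg x hx' hfx₀]
  have hlim : Tendsto (fun ε : ℝ => a + (∫ t in (0:ℝ)..z, g t) + ε * z)
      (nhdsWithin 0 (Ioi 0)) (nhds (a + ∫ t in (0:ℝ)..z, g t)) := by
    have : Continuous fun ε : ℝ => a + (∫ t in (0:ℝ)..z, g t) + ε * z := by fun_prop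
    simpa using (this.tendsto 0).mono_left nhdsWithin_le_nhds
  exact ge_of_tendsto hlim (eventually_mem_nhdsWithin.mono key)

/-- The difference of two hysteresis rates is controlled by the pressure difference as soon as the
capillary pressures are ordered. -/
theorem hysteresis_rate_sub_le {k p q u v a b : ℝ} (hk : 0 < k)
    (hu : k * u = max (p - a) 0) (hv : k * v = max (q - b) 0) (hab : b ≤ a) :
    u - v ≤ 1 / k * |p - q| := by
  rw [one_div_mul_eq_div, le_div_iff₀ hk]
  have h : max (p - a) 0 ≤ max (q - b) 0 + |p - q| :=
    max_le (by linarith [le_max_left (q - b) 0, le_abs_self (p - q)]) (by positivity)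
  linarith

/-- Stability of the hysteresis ODE `cτ s' = [p − p_c(s)]₊` with respect to the pressure
input: no Gronwall factor is needed since the right-hand side is nonincreasing in `s`. -/
theorem hysteresis_ode_stability
    (H c τ : ℝ) (hH : 0 < H) (hc : 0 < c) (hτ : 0 < τ)
    (pc : ℝ → ℝ) (hpcCont : ContinuousOn pc (Ioo (0:ℝ) 1))
    (hpcMono : MonotoneOn pc (Ioo (0:ℝ) 1))
    (p₁ p₂ : ℝ → ℝ)
    (hp₁ : ContinuousOn p₁ (Icc (0:ℝ) H)) (hp₂ : ContinuousOn p₂ (Icc (0:ℝ) H))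
    (s₁ s₂ s₁' s₂' : ℝ → ℝ)
    (hs₁Range : ∀ z ∈ Icc (0:ℝ) H, s₁ z ∈ Ioo (0:ℝ) 1)
    (hs₂Range : ∀ z ∈ Icc (0:ℝ) H, s₂ z ∈ Ioo (0:ℝ) 1)
    (hs₁Deriv : ∀ z ∈ Icc (0:ℝ) H, HasDerivWithinAt s₁ (s₁' z) (Icc (0:ℝ) H) z)
    (hs₂Deriv : ∀ z ∈ Icc (0:ℝ) H, HasDerivWithinAt s₂ (s₂' z) (Icc (0:ℝ) H) z)
    (hODE₁ : ∀ z ∈ Icc (0:ℝ) H, c * τ * s₁' z = max (p₁ z - pc (s₁ z)) 0)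
    (hODE₂ : ∀ z ∈ Icc (0:ℝ) H, c * τ * s₂' z = max (p₂ z - pc (s₂ z)) 0) :
    ∀ z ∈ Icc (0:ℝ) H,
      |s₁ z - s₂ z| ≤ |s₁ 0 - s₂ 0|
        + (1 / (c * τ)) * ∫ ζ in (0:ℝ)..z, |p₁ ζ - p₂ ζ| := by
  have hk : 0 < c * τ := mul_pos hc hτ
  have hg : ContinuousOn (fun ζ => 1 / (c * τ) * |p₁ ζ - p₂ ζ|) (Icc 0 H) :=
    continuousOn_const.mul (hp₁.sub hp₂).abs
  have hg₀ : ∀ x ∈ Icc 0 H, 0 ≤ 1 / (c * τ) * |p₁ x - p₂ x| := fun x _ => by positivity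
  intro z hz
  rw [← intervalIntegral.integral_const_mul]
  refine abs_sub_le_iff.2 ⟨?_, ?_⟩
  · refine le_add_integral_of_deriv_right_le (f := fun x => s₁ x - s₂ x)
      (abs_nonneg _) hg hg₀ (fun x hx => (hs₁Deriv x hx).sub (hs₂Deriv x hx))
      (le_abs_self _) (fun x hx h => ?_) z hz
    exact hysteresis_rate_sub_le hk (hODE₁ x hx) (hODE₂ x hx)
      (hpcMono (hs₂Range x hx) (hs₁Range x hx) (sub_nonneg.1 h))
  · refine le_add_integral_of_deriv_right_le (f := fun x => s₂ x - s₁ x)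
      (abs_nonneg _) hg hg₀ (fun x hx => (hs₂Deriv x hx).sub (hs₁Deriv x hx))
      (abs_sub_comm (s₁ 0) (s₂ 0) ▸ le_abs_self _) (fun x hx h => ?_) z hz
    rw [abs_sub_comm]
    exact hysteresis_rate_sub_le hk (hODE₂ x hx) (hODE₁ x hx)
      (hpcMono (hs₁Range x hx) (hs₂Range x hx) (sub_nonneg.1 h))
end
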